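/- Assume condition (★) holds. Then for every pair (V, W) ∈ Fix(φ), every irreducible Γ-invariant subspace of ℂ^d is contained in V or contained in W. -/

import Mathlib

open Module

namespace BZSVFix

variable {Γ : Type*} [Group Γ]

/-- A subspace `U ⊆ ℂ^d` is `Γ`-invariant for the representation `φ`. -/
def IsInvariant {d : ℕ} (φ : Representation ℂ Γ (Fin d → ℂ))
    (U : Submodule ℂ (Fin d → ℂ)) : Prop :=
  ∀ γ : Γ, ∀ x ∈ U, φ γ x ∈ U

/-- A `Γ`-invariant subspace is irreducible if it is nonzero and contains no `Γ`-invariant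
subspace other than `0` and itself. -/
def IsIrreducibleInv {d : ℕ} (φ : Representation ℂ Γ (Fin d → ℂ))
    (U : Submodule ℂ (Fin d → ℂ)) : Prop :=
  U ≠ ⊥ ∧ ∀ U' : Submodule ℂ (Fin d → ℂ), U' ≤ U → IsInvariant φ U' → U' = ⊥ ∨ U' = U

/-- Two `Γ`-invariant subspaces are isomorphic as `Γ`-modules: there is a `ℂ`-linear bijection
between them commuting with the action of every `φ γ`. -/
def IsoAsRep {d : ℕ} (φ : Representation ℂ Γ (Fin d → ℂ))
    (U₁ U₂ : Submodule ℂ (Fin d → ℂ)) : Prop :=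
  ∃ e : U₁ ≃ₗ[ℂ] U₂, ∀ (γ : Γ) (x : Fin d → ℂ) (hx : x ∈ U₁) (hγx : φ γ x ∈ U₁),
    ((e ⟨φ γ x, hγx⟩ : U₂) : Fin d → ℂ) = φ γ ((e ⟨x, hx⟩ : U₂) : Fin d → ℂ)

/-- `Fix(φ)`: the set of pairs `(V, W)` of `Γ`-invariant subspaces of `ℂ^d` with
`dim V = n`, `dim W = n + m`, `V ∩ W = 0` and `V + W = ℂ^d`. -/
def FixSet (n m : ℕ) {d : ℕ} (φ : Representation ℂ Γ (Fin d → ℂ)) :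
    Set (Submodule ℂ (Fin d → ℂ) × Submodule ℂ (Fin d → ℂ)) :=
  {p | IsInvariant φ p.1 ∧ IsInvariant φ p.2 ∧
    finrank ℂ p.1 = n ∧ finrank ℂ p.2 = n + m ∧ p.1 ⊓ p.2 = ⊥ ∧ p.1 ⊔ p.2 = ⊤}

/-- Condition (★): for every subset `I` of the index set with `∑_{i ∈ I} n_i = n`, the
constituents `U_i`, `i ∈ I`, and `U_j`, `j ∉ I`, are pairwise non-isomorphic. -/
def StarCondition {k : ℕ} (n : ℕ) (nι : Fin k → ℕ) {d : ℕ}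
    (φ : Representation ℂ Γ (Fin d → ℂ)) (U : Fin k → Submodule ℂ (Fin d → ℂ)) : Prop :=
  ∀ I : Finset (Fin k), (∑ i ∈ I, nι i) = n →
    ∀ i ∈ I, ∀ j ∉ I, ¬ IsoAsRep φ (U i) (U j)

section

variable {d k : ℕ} {φ : Representation ℂ Γ (Fin d → ℂ)} {A B V W : Submodule ℂ (Fin d → ℂ)}
  {U : Fin k → Submodule ℂ (Fin d → ℂ)}

lemma IsInvariant.inf (hA : IsInvariant φ A) (hB : IsInvariant φ B) : IsInvariant φ (A ⊓ B) :=
  fun γ x hx => ⟨hA γ x hx.1, hB γ x hx.2⟩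

lemma IsInvariant.sup (hA : IsInvariant φ A) (hB : IsInvariant φ B) : IsInvariant φ (A ⊔ B) := by
  intro γ x hx
  obtain ⟨a, ha, b, hb, rfl⟩ := Submodule.mem_sup.1 hx
  rw [map_add]
  exact Submodule.add_mem_sup (hA γ a ha) (hB γ b hb)

lemma IsInvariant.finset_sup (hU : ∀ i, IsInvariant φ (U i)) (J : Finset (Fin k)) :
    IsInvariant φ (J.sup U) := by
  induction J using Finset.induction_on with
  | empty =>
    intro γ x hx
    have hx0 : x = 0 := by simpa using hx
    simp [hx0]
  | insert i J _ ih =>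
    rw [Finset.sup_insert]
    exact (hU i).sup ih

lemma IsoAsRep.symm (hA : IsInvariant φ A) (h : IsoAsRep φ A B) : IsoAsRep φ B A := by
  obtain ⟨e, he⟩ := h
  refine ⟨e.symm, fun γ y hy hγy => ?_⟩
  have hx := (e.symm ⟨y, hy⟩).2
  have key := he γ _ hx (hA γ _ hx)
  have hsymm : e.symm ⟨φ γ y, hγy⟩ = ⟨φ γ (e.symm ⟨y, hy⟩ : A), hA γ _ hx⟩ := by
    rw [LinearEquiv.symm_apply_eq]
    apply Subtype.ext
    rw [key]
    simp
  rw [hsymm]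

lemma IsoAsRep.trans {C : Submodule ℂ (Fin d → ℂ)} (hB : IsInvariant φ B)
    (h : IsoAsRep φ A B) (h' : IsoAsRep φ B C) : IsoAsRep φ A C := by
  obtain ⟨e, he⟩ := h
  obtain ⟨f, hf⟩ := h'
  refine ⟨e.trans f, fun γ x hx hγx => ?_⟩
  have hy := (e ⟨x, hx⟩).2
  have hmap : e ⟨φ γ x, hγx⟩ = ⟨φ γ (e ⟨x, hx⟩ : B), hB γ _ hy⟩ := Subtype.ext (he γ x hx hγx)
  rw [LinearEquiv.trans_apply, LinearEquiv.trans_apply, hmap]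
  exact hf γ _ hy (hB γ _ hy)

/-- Schur's lemma: an equivariant map which sends one irreducible subspace into another and does
not vanish on the first one restricts to an isomorphism. -/
lemma IsIrreducibleInv.isoAsRep (hA : IsInvariant φ A) (hA' : IsIrreducibleInv φ A)
    (hB' : IsIrreducibleInv φ B) (f : (Fin d → ℂ) →ₗ[ℂ] (Fin d → ℂ))
    (hf : ∀ γ x, f (φ γ x) = φ γ (f x)) (hfB : ∀ x ∈ A, f x ∈ B) {x : Fin d → ℂ}
    (hx : x ∈ A) (hfx : f x ≠ 0) : IsoAsRep φ A B := by
  have hker : A ⊓ LinearMap.ker f = ⊥ := by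
    refine (hA'.2 _ inf_le_left (hA.inf fun γ y hy => ?_)).resolve_right fun h => hfx ?_
    · rw [LinearMap.mem_ker] at hy ⊢
      rw [hf, hy, map_zero]
    · exact (inf_eq_left.1 h) hx
  have hmap : A.map f = B := by
    refine (hB'.2 _ (Submodule.map_le_iff_le_comap.2 hfB) ?_).resolve_left fun h => hfx ?_
    · rintro γ _ ⟨y, hy, rfl⟩
      exact ⟨φ γ y, hA γ y hy, hf γ y⟩
    · simpa [h] using Submodule.mem_map_of_mem (f := f) hx
  refine ⟨LinearEquiv.ofBijective (f.restrict hfB) ⟨?_, ?_⟩, fun γ x hx hγx => hf γ x⟩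
  · rw [← LinearMap.ker_eq_bot, eq_bot_iff]
    intro y hy
    have hfy : f y = 0 := congrArg Subtype.val (LinearMap.mem_ker.1 hy)
    have hy0 : (y : Fin d → ℂ) ∈ A ⊓ LinearMap.ker f := ⟨y.2, hfy⟩
    rw [hker] at hy0
    simpa using hy0
  · rintro ⟨y, hy⟩
    rw [← hmap] at hy
    obtain ⟨z, hz, rfl⟩ := hy
    exact ⟨⟨z, hz⟩, rfl⟩

lemma projection_equivariant (hV : IsInvariant φ V) (hW : IsInvariant φ W) (h : IsCompl V W)
    (γ : Γ) (x : Fin d → ℂ) :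
    V.projection W h (φ γ x) = φ γ (V.projection W h x) := by
  conv_lhs => rw [← Submodule.projection_add_projection_eq_self h x]
  rw [map_add, map_add,
    Submodule.projection_apply_of_mem_left h (hV γ _ (Submodule.projection_apply_mem h x)),
    Submodule.projection_apply_of_mem_right h (hW γ _ (Submodule.projection_apply_mem h.symm x)),
    add_zero]

lemma isCompl_finset_sup_compl (hind : iSupIndep U) (htop : iSup U = ⊤) (J : Finset (Fin k)) :
    IsCompl (Jᶜ.sup U) (J.sup U) := by
  constructor
  · exact hind.sup_indep_univ.disjoint_sup_sup (Finset.subset_univ _) (Finset.subset_univ _)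
      disjoint_compl_left
  · rw [codisjoint_iff, ← Finset.sup_union, ← htop, ← Finset.sup_univ_eq_iSup]
    congr 1
    rw [Finset.union_comm, Finset.union_compl]

lemma finrank_finset_sup (hind : iSupIndep U) (J : Finset (Fin k)) :
    finrank ℂ (J.sup U : Submodule ℂ (Fin d → ℂ)) = ∑ i ∈ J, finrank ℂ (U i) := by
  induction J using Finset.induction_on with
  | empty => simp
  | insert i J hi ih =>
    have hdisj : Disjoint (U i) (J.sup U) :=
      hind.sup_indep_univ (Finset.subset_univ J) (Finset.mem_univ i) hi
    have h := Submodule.finrank_sup_add_finrank_inf_eq (U i) (J.sup U)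
    rw [hdisj.eq_bot, finrank_bot, add_zero] at h
    rw [Finset.sup_insert, Finset.sum_insert hi, h, ih]

/-- Every invariant subspace has a complement which is a sum of some of the constituents. -/
lemma exists_isCompl_finset_sup (hU : ∀ i, IsInvariant φ (U i))
    (hirr : ∀ i, IsIrreducibleInv φ (U i)) (htop : iSup U = ⊤) (hV : IsInvariant φ V) :
    ∃ J : Finset (Fin k), IsCompl (J.sup U) V := by
  obtain ⟨J, hJ⟩ := (Set.toFinite {J : Finset (Fin k) | Disjoint V (J.sup U)}).exists_maximal
    ⟨∅, by simp⟩
  have hJV : Disjoint V (J.sup U) := hJ.prop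
  refine ⟨J, hJV.symm, ?_⟩
  rw [codisjoint_iff, sup_comm, eq_top_iff, ← htop]
  refine iSup_le fun i => ?_
  have hinv := hV.sup (IsInvariant.finset_sup hU J)
  rcases (hirr i).2 _ inf_le_left ((hU i).inf hinv) with h | h
  · have hdisj : Disjoint V ((insert i J).sup U) := by
      rw [Finset.sup_insert, sup_comm]
      exact hJV.disjoint_sup_right_of_disjoint_sup_left (disjoint_iff.2 h).symm
    have hi : i ∈ J := hJ.le_of_ge hdisj (Finset.subset_insert i J) (Finset.mem_insert_self i J)
    exact (Finset.le_sup hi).trans le_sup_right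
  · exact inf_eq_left.1 h

lemma exists_isoAsRep_of_notMem (hU : ∀ i, IsInvariant φ (U i))
    (hirr : ∀ i, IsIrreducibleInv φ (U i)) (hind : iSupIndep U) (htop : iSup U = ⊤)
    (hA : IsInvariant φ A) (hA' : IsIrreducibleInv φ A) (f : (Fin d → ℂ) →ₗ[ℂ] (Fin d → ℂ))
    (hf : ∀ γ x, f (φ γ x) = φ γ (f x)) {x : Fin d → ℂ} (hx : x ∈ A) {J : Finset (Fin k)}
    (hfx : f x ∉ J.sup U) : ∃ i ∉ J, IsoAsRep φ A (U i) := by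
  have hmem : f x ∈ ⨆ i ∈ Finset.univ, U i := by simp [htop]
  obtain ⟨μ, hμ⟩ := (Submodule.mem_iSup_finset_iff_exists_sum _ _).1 hmem
  obtain ⟨i, hiJ, hi⟩ : ∃ i ∉ J, (μ i : Fin d → ℂ) ≠ 0 := by
    by_contra! h
    refine hfx ?_
    rw [← hμ, ← Finset.sum_subset (Finset.subset_univ J) fun i _ hi => h i hi]
    exact Submodule.sum_mem _ fun i hi => Finset.le_sup (f := U) hi (μ i).2
  have hc : IsCompl (U i) (({i}ᶜ : Finset (Fin k)).sup U) := by
    simpa using (isCompl_finset_sup_compl hind htop {i}).symm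
  refine ⟨i, hiJ, hA'.isoAsRep hA (hirr i) ((U i).projection _ hc ∘ₗ f) (fun γ y => ?_)
    (fun y _ => Submodule.projection_apply_mem hc _) hx ?_⟩
  · rw [LinearMap.comp_apply, hf, projection_equivariant (hU i) (IsInvariant.finset_sup hU _) hc]
    rfl
  · rw [LinearMap.comp_apply, ← hμ, map_sum, Finset.sum_eq_single i]
    · rwa [Submodule.projection_apply_of_mem_left hc (μ i).2]
    · intro j _ hj
      exact Submodule.projection_apply_of_mem_right hc
        (Finset.le_sup (f := U) (by simpa using hj) (μ j).2)
    · simp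

end

/-- Assume condition (★) holds. Then for every pair `(V, W) ∈ Fix(φ)`, every irreducible
`Γ`-invariant subspace of `ℂ^d` is contained in `V` or contained in `W`. -/
theorem irreducible_le_of_mem_fixSet {n m k : ℕ} (hn : 1 ≤ n)
    (φ : Representation ℂ Γ (Fin (2 * n + m) → ℂ))
    (U : Fin k → Submodule ℂ (Fin (2 * n + m) → ℂ)) (nι : Fin k → ℕ)
    (hinv : ∀ i, IsInvariant φ (U i)) (hirr : ∀ i, IsIrreducibleInv φ (U i))
    (hsum : DirectSum.IsInternal U)
    (hdim : ∀ i, finrank ℂ (U i) = nι i)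
    (hstar : StarCondition n nι φ U) :
    ∀ p ∈ FixSet n m φ, ∀ U' : Submodule ℂ (Fin (2 * n + m) → ℂ),
      IsInvariant φ U' → IsIrreducibleInv φ U' → U' ≤ p.1 ∨ U' ≤ p.2 := by
  rintro ⟨V, W⟩ ⟨hV, hW, hVn, -, hVW, hVW'⟩ A hA hA'
  dsimp only at hV hW hVn hVW hVW'
  have hind := hsum.submodule_iSupIndep
  have htop := hsum.submodule_iSup_eq_top
  have hc : IsCompl V W := ⟨disjoint_iff.2 hVW, codisjoint_iff.2 hVW'⟩
  obtain ⟨J, hJ⟩ := exists_isCompl_finset_sup hinv hirr htop hV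
  have hJ' := isCompl_finset_sup_compl hind htop J
  have hcard : ∑ i ∈ Jᶜ, nι i = n := by
    have h₁ := Submodule.finrank_add_eq_of_isCompl hJ
    have h₂ := Submodule.finrank_add_eq_of_isCompl hJ'
    have h₃ := finrank_finset_sup hind Jᶜ
    simp only [hdim] at h₃
    omega
  by_contra! h
  obtain ⟨⟨x, hx, hxV⟩, ⟨y, hy, hyW⟩⟩ := h.imp SetLike.not_le_iff_exists.1
    SetLike.not_le_iff_exists.1
  obtain ⟨i, hi, ei⟩ := exists_isoAsRep_of_notMem hinv hirr hind htop hA hA'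
    (V.projection W hc) (projection_equivariant hV hW hc) hy (J := J) fun hmem =>
      hyW ((Submodule.projection_apply_eq_zero_iff hc).1
        (Submodule.disjoint_def.1 hJ.disjoint _ hmem (Submodule.projection_apply_mem hc y)))
  obtain ⟨j, hj, ej⟩ := exists_isoAsRep_of_notMem hinv hirr hind htop hA hA'
    ((J.sup U).projection V hJ)
    (projection_equivariant (IsInvariant.finset_sup hinv J) hV hJ) hx (J := Jᶜ) fun hmem =>
      hxV ((Submodule.projection_apply_eq_zero_iff hJ).1
        (Submodule.disjoint_def.1 hJ'.disjoint _ hmem (Submodule.projection_apply_mem hJ x)))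
  exact hstar Jᶜ hcard i (Finset.mem_compl.2 hi) j hj ((ei.symm hA).trans hA ej)

end BZSVFix
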